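/- Let Y be a family of 2-dimensional subspaces of a 4-dimensional F_q-vector space arising from a weight function wt on points with every line-weight in {0,1} (i.e., Y is a Boolean degree 1 function on J_q(4,2)). If some point has weight strictly greater than q/(q+1), then Y is trivial and contains a point-pencil. -/

import Mathlib

open Module

/-- The total weight of the points of a subspace `L`. -/
noncomputable def subWeight {F V : Type} [Field F] [AddCommGroup V] [Module F V]
    (wt : Submodule F V → ℝ) (L : Submodule F V) : ℝ :=
  ∑ᶠ P ∈ {P : Submodule F V | finrank F P = 1 ∧ P ≤ L}, wt P

/-- The set of all lines (2-spaces). -/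
def allLines (F V : Type) [Field F] [AddCommGroup V] [Module F V] : Set (Submodule F V) :=
  {L | finrank F L = 2}

/-- The point-pencil of a point `P`: all lines through `P`. -/
def pencil {F V : Type} [Field F] [AddCommGroup V] [Module F V] (P : Submodule F V) :
    Set (Submodule F V) :=
  {L | finrank F L = 2 ∧ P ≤ L}

/-- The lines contained in a subspace `H`. -/
def linesIn {F V : Type} [Field F] [AddCommGroup V] [Module F V] (H : Submodule F V) :
    Set (Submodule F V) :=
  {L | finrank F L = 2 ∧ L ≤ H}

/-- The trivial examples of Boolean degree 1 functions on lines: `∅`, a point-pencil,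
the lines of a hyperplane, the union of a point-pencil and the lines of a hyperplane
not containing the point, and complements (within all lines) of these. -/
def IsTrivialCL {F V : Type} [Field F] [AddCommGroup V] [Module F V]
    (Y : Set (Submodule F V)) : Prop :=
  ∃ Z : Set (Submodule F V),
    (Z = ∅ ∨
     (∃ P : Submodule F V, finrank F P = 1 ∧ Z = pencil P) ∨
     (∃ H : Submodule F V, finrank F H = finrank F V - 1 ∧ Z = linesIn H) ∨
     (∃ P H : Submodule F V, finrank F P = 1 ∧ finrank F H = finrank F V - 1 ∧
        ¬ P ≤ H ∧ Z = pencil P ∪ linesIn H)) ∧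
    (Y = Z ∨ Y = allLines F V \ Z)


section helpers
open scoped Classical
variable {F V : Type} [Field F] [Fintype F] [AddCommGroup V] [Module F V] [Module.Finite F V]

noncomputable instance subFintype : Fintype (Submodule F V) := by
  haveI : Finite V := Module.finite_of_finite F
  haveI : Finite (Submodule F V) := Finite.of_injective (fun S : Submodule F V => (S : Set V)) SetLike.coe_injective
  exact Fintype.ofFinite _

noncomputable def pts (S : Submodule F V) : Finset (Submodule F V) :=
  Finset.univ.filter fun P => finrank F P = 1 ∧ P ≤ S

noncomputable def up (A S : Submodule F V) : Finset (Submodule F V) :=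
  Finset.univ.filter fun B => finrank F B = finrank F A + 1 ∧ A ≤ B ∧ B ≤ S

lemma mem_pts {S P : Submodule F V} : P ∈ pts S ↔ finrank F P = 1 ∧ P ≤ S := by simp [pts]
lemma mem_up {A S B : Submodule F V} :
    B ∈ up A S ↔ finrank F B = finrank F A + 1 ∧ A ≤ B ∧ B ≤ S := by simp [up]

lemma subWeight_eq (wt : Submodule F V → ℝ) (S : Submodule F V) :
    subWeight wt S = ∑ P ∈ pts S, wt P := by
  unfold subWeight
  rw [← finsum_mem_coe_finset]
  congr 1; ext P; simp [pts]

lemma point_inf {Q A : Submodule F V} (hQ : finrank F Q = 1) (h : ¬ Q ≤ A) : Q ⊓ A = ⊥ := by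
  have h1 : finrank F (Q ⊓ A : Submodule F V) < 1 := by
    rw [← hQ]
    apply Submodule.finrank_lt_finrank_of_lt
    exact lt_of_le_of_ne inf_le_left (fun h' => h (inf_eq_left.mp h'))
  exact Submodule.finrank_eq_zero.mp (by omega)

lemma point_sup {Q A : Submodule F V} (hQ : finrank F Q = 1) (h : ¬ Q ≤ A) :
    finrank F (A ⊔ Q : Submodule F V) = finrank F A + 1 := by
  have := Submodule.finrank_sup_add_finrank_inf_eq A Q
  rw [inf_comm, point_inf hQ h, finrank_bot, hQ] at this
  omega

lemma up_filter {A S Q : Submodule F V} (hAS : A ≤ S) (hQ : Q ∈ pts S) (h : ¬ Q ≤ A) :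
    (up A S).filter (fun B => Q ≤ B) = {A ⊔ Q} := by
  rw [mem_pts] at hQ
  ext B
  simp only [Finset.mem_filter, mem_up, Finset.mem_singleton]
  constructor
  · rintro ⟨⟨h1, h2, h3⟩, h4⟩
    symm
    apply Submodule.eq_of_le_of_finrank_eq (sup_le h2 h4)
    rw [point_sup hQ.1 h, h1]
  · rintro rfl
    exact ⟨⟨point_sup hQ.1 h, le_sup_left, sup_le hAS hQ.2⟩, le_sup_right⟩

lemma sum_up (wt : Submodule F V → ℝ) {A S : Submodule F V} (hAS : A ≤ S) :
    ∑ B ∈ up A S, subWeight wt B = subWeight wt S + (((up A S).card : ℝ) - 1) * subWeight wt A := by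
  have e1 : ∑ B ∈ up A S, subWeight wt B
      = ∑ Q ∈ pts S, (((up A S).filter (fun B => Q ≤ B)).card : ℝ) * wt Q := by
    have : ∀ B ∈ up A S, subWeight wt B = ∑ Q ∈ pts S, if Q ≤ B then wt Q else 0 := by
      intro B hB
      rw [subWeight_eq, ← Finset.sum_filter]
      apply Finset.sum_congr _ (fun _ _ => rfl)
      ext Q
      simp only [mem_pts, Finset.mem_filter]
      have := (mem_up.mp hB).2.2
      exact ⟨fun h => ⟨⟨h.1, h.2.trans this⟩, h.2⟩, fun h => ⟨h.1.1, h.2⟩⟩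
    rw [Finset.sum_congr rfl this, Finset.sum_comm]
    apply Finset.sum_congr rfl
    intro Q _
    rw [← Finset.sum_filter, Finset.sum_const, nsmul_eq_mul]
  have e2 : ∀ Q ∈ pts S, (((up A S).filter (fun B => Q ≤ B)).card : ℝ) * wt Q
      = wt Q + if Q ≤ A then (((up A S).card : ℝ) - 1) * wt Q else 0 := by
    intro Q hQ
    by_cases h : Q ≤ A
    · have : (up A S).filter (fun B => Q ≤ B) = up A S := by
        apply Finset.filter_true_of_mem
        intro B hB
        exact h.trans (mem_up.mp hB).2.1
      rw [this, if_pos h]; ring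
    · rw [up_filter hAS hQ h, if_neg h]; simp
  have e3 : (pts S).filter (fun Q => Q ≤ A) = pts A := by
    ext Q
    simp only [mem_pts, Finset.mem_filter]
    exact ⟨fun h => ⟨h.1.1, h.2⟩, fun h => ⟨⟨h.1, h.2.trans hAS⟩, h.2⟩⟩
  rw [e1, Finset.sum_congr rfl e2, Finset.sum_add_distrib, ← Finset.sum_filter, e3,
    ← Finset.mul_sum, ← subWeight_eq, ← subWeight_eq]

lemma card_pts (S : Submodule F V) :
    ((pts S).card : ℝ) * ((Fintype.card F : ℝ) - 1) = (Fintype.card F : ℝ) ^ finrank F S - 1 := by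
  haveI : Finite V := Module.finite_of_finite F
  have h1 : (pts S).card = Nat.card (Projectivization F S) := by
    rw [Nat.card_congr (Projectivization.equivSubmodule F S), Nat.card_eq_fintype_card,
      Fintype.card_subtype]
    symm
    apply Finset.card_bij (fun T _ => T.map S.subtype)
    · intro T hT
      rw [mem_pts, Submodule.finrank_map_subtype_eq]
      exact ⟨(Finset.mem_filter.mp hT).2, Submodule.map_subtype_le S T⟩
    · intro T _ T' _ h
      exact Submodule.map_injective_of_injective S.injective_subtype h
    · intro Q hQ
      rw [mem_pts] at hQ
      have e : (Q.comap S.subtype).map S.subtype = Q := by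
        rw [Submodule.map_comap_subtype, inf_eq_right.mpr hQ.2]
      refine ⟨Q.comap S.subtype, ?_, e⟩
      rw [Finset.mem_filter]
      refine ⟨Finset.mem_univ _, ?_⟩
      rw [← Submodule.finrank_map_subtype_eq, e, hQ.1]
  have h2 := Projectivization.card' F S
  rw [← h1, Module.natCard_eq_pow_finrank (K := F), Nat.card_eq_fintype_card] at h2
  have h3 : 1 ≤ Fintype.card F := Fintype.card_pos
  have h4 := congrArg (Nat.cast : ℕ → ℝ) h2
  push_cast [Nat.cast_sub h3] at h4
  linarith

lemma card_up {A S : Submodule F V} (hAS : A ≤ S) :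
    ((up A S).card : ℝ) * ((Fintype.card F : ℝ) - 1) * (Fintype.card F : ℝ) ^ finrank F A
      = (Fintype.card F : ℝ) ^ finrank F S - (Fintype.card F : ℝ) ^ finrank F A := by
  have h := sum_up (fun _ => (1 : ℝ)) hAS
  have hc : ∀ T : Submodule F V, subWeight (fun _ => (1 : ℝ)) T = (pts T).card := by
    intro T; rw [subWeight_eq]; simp
  simp only [hc] at h
  have h2 : ∑ B ∈ up A S, ((pts B).card : ℝ) * ((Fintype.card F : ℝ) - 1)
      = ∑ B ∈ up A S, ((Fintype.card F : ℝ) ^ (finrank F A + 1) - 1) := by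
    apply Finset.sum_congr rfl
    intro B hB
    rw [card_pts, (mem_up.mp hB).1]
  rw [← Finset.sum_mul, h, Finset.sum_const, nsmul_eq_mul] at h2
  have hA := card_pts A
  have hS := card_pts S
  rw [pow_succ] at h2
  linear_combination -h2 + hS + ((up A S).card - 1 : ℝ) * hA

lemma q_two : (2 : ℝ) ≤ (Fintype.card F : ℝ) := by
  have : 1 < Fintype.card F := Fintype.one_lt_card
  exact_mod_cast this

lemma card_up_two {A S : Submodule F V} (hAS : A ≤ S) (h : finrank F S = finrank F A + 2) :
    ((up A S).card : ℝ) = (Fintype.card F : ℝ) + 1 := by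
  have h1 := card_up hAS
  have hq := q_two (F := F)
  have hp : (Fintype.card F : ℝ) ^ finrank F A ≠ 0 := by positivity
  have h0 : (Fintype.card F : ℝ) - 1 ≠ 0 := by linarith
  rw [h, pow_add] at h1
  apply mul_right_cancel₀ h0
  apply mul_right_cancel₀ hp
  linear_combination h1

lemma card_up_three {A S : Submodule F V} (hAS : A ≤ S) (h : finrank F S = finrank F A + 3) :
    ((up A S).card : ℝ) = (Fintype.card F : ℝ) ^ 2 + (Fintype.card F : ℝ) + 1 := by
  have h1 := card_up hAS
  have hq := q_two (F := F)
  have hp : (Fintype.card F : ℝ) ^ finrank F A ≠ 0 := by positivity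
  have h0 : (Fintype.card F : ℝ) - 1 ≠ 0 := by linarith
  rw [h, pow_add] at h1
  apply mul_right_cancel₀ h0
  apply mul_right_cancel₀ hp
  linear_combination h1

noncomputable def linesF (S : Submodule F V) : Finset (Submodule F V) :=
  Finset.univ.filter fun L => finrank F L = 2 ∧ L ≤ S

lemma mem_linesF {S L : Submodule F V} : L ∈ linesF S ↔ finrank F L = 2 ∧ L ≤ S := by
  simp [linesF]

lemma sum_linesF (wt : Submodule F V → ℝ) (S : Submodule F V) (θ : ℝ)
    (hθ : ∀ Q ∈ pts S, ((up Q S).card : ℝ) = θ) :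
    ∑ L ∈ linesF S, subWeight wt L = θ * subWeight wt S := by
  have : ∀ B ∈ linesF S, subWeight wt B = ∑ Q ∈ pts S, if Q ≤ B then wt Q else 0 := by
    intro B hB
    rw [subWeight_eq, ← Finset.sum_filter]
    apply Finset.sum_congr _ (fun _ _ => rfl)
    ext Q
    simp only [mem_pts, Finset.mem_filter]
    have := (mem_linesF.mp hB).2
    exact ⟨fun h => ⟨⟨h.1, h.2.trans this⟩, h.2⟩, fun h => ⟨h.1.1, h.2⟩⟩
  rw [Finset.sum_congr rfl this, Finset.sum_comm, subWeight_eq, Finset.mul_sum]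
  apply Finset.sum_congr rfl
  intro Q hQ
  rw [← Finset.sum_filter, Finset.sum_const, nsmul_eq_mul, ← hθ Q hQ]
  congr 3
  ext L
  rw [mem_pts] at hQ
  simp only [Finset.mem_filter, mem_linesF, mem_up, hQ.1]
  tauto

lemma subWeight_point (wt : Submodule F V → ℝ) {Q : Submodule F V} (hQ : finrank F Q = 1) :
    subWeight wt Q = wt Q := by
  have : pts Q = {Q} := by
    ext R
    simp only [mem_pts, Finset.mem_singleton]
    constructor
    · rintro ⟨h1, h2⟩
      exact Submodule.eq_of_le_of_finrank_eq h2 (by omega)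
    · rintro rfl
      exact ⟨hQ, le_rfl⟩
  rw [subWeight_eq, this, Finset.sum_singleton]

lemma pen_eq (wt : Submodule F V → ℝ) {Q H : Submodule F V} (hQ : finrank F Q = 1)
    (hH : finrank F H = 3) (h : Q ≤ H) :
    ∑ L ∈ up Q H, subWeight wt L = subWeight wt H + (Fintype.card F : ℝ) * wt Q := by
  rw [sum_up wt h, card_up_two h (by omega), subWeight_point wt hQ]; ring

lemma star_eq (wt : Submodule F V → ℝ) (hdim : finrank F V = 4) {Q : Submodule F V}
    (hQ : finrank F Q = 1) :
    ∑ L ∈ up Q ⊤, subWeight wt L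
      = subWeight wt ⊤ + ((Fintype.card F : ℝ) ^ 2 + (Fintype.card F : ℝ)) * wt Q := by
  rw [sum_up wt le_top, card_up_three le_top (by rw [finrank_top]; omega),
    subWeight_point wt hQ]; ring

lemma plane_eq (wt : Submodule F V → ℝ) {H : Submodule F V} (hH : finrank F H = 3) :
    ∑ L ∈ linesF H, subWeight wt L = ((Fintype.card F : ℝ) + 1) * subWeight wt H := by
  apply sum_linesF
  intro Q hQ
  rw [mem_pts] at hQ
  exact card_up_two hQ.2 (by omega)

lemma all_eq (wt : Submodule F V → ℝ) (hdim : finrank F V = 4) :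
    ∑ L ∈ linesF (⊤ : Submodule F V), subWeight wt L
      = ((Fintype.card F : ℝ) ^ 2 + (Fintype.card F : ℝ) + 1) * subWeight wt ⊤ := by
  apply sum_linesF
  intro Q hQ
  rw [mem_pts] at hQ
  exact card_up_three hQ.2 (by rw [finrank_top]; omega)

lemma planes_on_line (wt : Submodule F V → ℝ) (hdim : finrank F V = 4) {L : Submodule F V}
    (hL : finrank F L = 2) :
    ∑ E ∈ up L ⊤, subWeight wt E
      = subWeight wt ⊤ + (Fintype.card F : ℝ) * subWeight wt L := by
  rw [sum_up wt le_top, card_up_two le_top (by rw [finrank_top]; omega)]; ring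

lemma card_linesF {H : Submodule F V} (hH : finrank F H = 3) :
    ((linesF H).card : ℝ) = (Fintype.card F : ℝ) ^ 2 + (Fintype.card F : ℝ) + 1 := by
  have h := plane_eq (fun _ => (1 : ℝ)) hH
  have hc : ∀ T : Submodule F V, subWeight (fun _ => (1 : ℝ)) T = (pts T).card := by
    intro T; rw [subWeight_eq]; simp
  simp only [hc] at h
  have hq := q_two (F := F)
  have h0 : (Fintype.card F : ℝ) - 1 ≠ 0 := by linarith
  have h1 : (Fintype.card F : ℝ) + 1 ≠ 0 := by linarith
  have h2 : ∑ B ∈ linesF H, ((pts B).card : ℝ) * ((Fintype.card F : ℝ) - 1)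
      = ∑ B ∈ linesF H, ((Fintype.card F : ℝ) ^ 2 - 1) := by
    apply Finset.sum_congr rfl
    intro B hB
    rw [card_pts, (mem_linesF.mp hB).1]
  rw [← Finset.sum_mul, h, Finset.sum_const, nsmul_eq_mul] at h2
  have h3 := card_pts H
  rw [hH] at h3
  apply mul_right_cancel₀ h0
  apply mul_right_cancel₀ h1
  linear_combination -h2 + (Fintype.card F + 1 : ℝ) * h3

lemma sum_bool (f : Submodule F V → ℝ) (s : Finset (Submodule F V))
    (h : ∀ L ∈ s, f L = 0 ∨ f L = 1) : ∃ n : ℕ, ∑ L ∈ s, f L = n := by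
  refine ⟨∑ L ∈ s, if f L = 1 then 1 else 0, ?_⟩
  push_cast
  apply Finset.sum_congr rfl
  intro L hL
  rcases h L hL with h | h <;> simp [h]

lemma exists_up (A : Submodule F V) (h : finrank F A < finrank F V) :
    ∃ B : Submodule F V, A ≤ B ∧ finrank F B = finrank F A + 1 := by
  have hne : A ≠ ⊤ := by
    rintro rfl
    rw [finrank_top] at h; omega
  obtain ⟨v, -, hv⟩ := SetLike.exists_of_lt (lt_top_iff_ne_top.mpr hne)
  have hv0 : v ≠ 0 := by rintro rfl; exact hv A.zero_mem
  refine ⟨A ⊔ Submodule.span F {v}, le_sup_left, point_sup (finrank_span_singleton hv0) ?_⟩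
  rwa [Submodule.span_singleton_le_iff_mem]

lemma exists_plane (hdim : finrank F V = 4) (A : Submodule F V) (hA : finrank F A = 1 ∨ finrank F A = 2) :
    ∃ B : Submodule F V, A ≤ B ∧ finrank F B = 3 := by
  rcases hA with hA | hA
  · obtain ⟨B, h1, h2⟩ := exists_up A (by omega)
    obtain ⟨C, h3, h4⟩ := exists_up B (by omega)
    exact ⟨C, h1.trans h3, by omega⟩
  · obtain ⟨B, h1, h2⟩ := exists_up A (by omega)
    exact ⟨B, h1, by omega⟩

lemma exists_plane₂ (hdim : finrank F V = 4) {P Q : Submodule F V} (hP : finrank F P = 1)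
    (hQ : finrank F Q = 1) :
    ∃ B : Submodule F V, P ≤ B ∧ Q ≤ B ∧ finrank F B = 3 := by
  by_cases h : Q ≤ P
  · obtain ⟨B, h1, h2⟩ := exists_plane hdim P (Or.inl hP)
    exact ⟨B, h1, h.trans h1, h2⟩
  · obtain ⟨B, h1, h2⟩ := exists_plane hdim (P ⊔ Q) (Or.inr (by rw [point_sup hQ h, hP]))
    exact ⟨B, le_sup_left.trans h1, le_sup_right.trans h1, h2⟩

lemma exists_point {E : Submodule F V} (hE : finrank F E = 3) :
    ∃ Q : Submodule F V, finrank F Q = 1 ∧ Q ≤ E := by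
  have : E ≠ ⊥ := by rintro rfl; simp at hE
  obtain ⟨v, hv, hv0⟩ := Submodule.exists_mem_ne_zero_of_ne_bot this
  exact ⟨Submodule.span F {v}, finrank_span_singleton hv0, by
    rwa [Submodule.span_singleton_le_iff_mem]⟩

lemma core (wt : Submodule F V → ℝ) (hdim : finrank F V = 4)
    (hb : ∀ L : Submodule F V, finrank F L = 2 → subWeight wt L = 0 ∨ subWeight wt L = 1)
    (P : Submodule F V) (hP : finrank F P = 1)
    (hz : ∀ L : Submodule F V, finrank F L = 2 → P ≤ L → subWeight wt L = 0)
    (hW : subWeight wt ⊤ < (Fintype.card F : ℝ)) :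
    (∀ L : Submodule F V, finrank F L = 2 → subWeight wt L = 0) ∨
    ∃ E : Submodule F V, finrank F E = 3 ∧ ¬ P ≤ E ∧
      ∀ L : Submodule F V, finrank F L = 2 → (subWeight wt L = 1 ↔ L ≤ E) := by
  have hq := q_two (F := F)
  set q : ℝ := (Fintype.card F : ℝ) with hqdef
  set W := subWeight wt ⊤ with hWdef
  have hbup : ∀ Q H : Submodule F V, finrank F Q = 1 → ∀ L ∈ up Q H,
      subWeight wt L = 0 ∨ subWeight wt L = 1 := fun Q H hQ L hL =>
    hb L (by rw [(mem_up.mp hL).1, hQ])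
  have hbl : ∀ H : Submodule F V, ∀ L ∈ linesF H,
      subWeight wt L = 0 ∨ subWeight wt L = 1 := fun H L hL => hb L (mem_linesF.mp hL).1
  -- planes through P
  have hPH : ∀ H : Submodule F V, finrank F H = 3 → P ≤ H → (q + 1) * subWeight wt H = W := by
    intro H hH hle
    have h1 := pen_eq wt hP hH hle
    have h2 := star_eq wt hdim hP
    rw [Finset.sum_eq_zero] at h1 h2
    · linear_combination h2 - (q + 1) * h1
    · intro L hL
      have := mem_up.mp hL
      exact hz L (by omega) this.2.1
    · intro L hL
      have := mem_up.mp hL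
      exact hz L (by omega) this.2.1
  obtain ⟨x, hx⟩ : ∃ x : ℕ, W = x := by
    obtain ⟨H, h1, h2⟩ := exists_plane hdim P (Or.inl hP)
    obtain ⟨n, hn⟩ := sum_bool _ _ (hbl H)
    exact ⟨n, by rw [← hn, plane_eq wt h2, hPH H h2 h1]⟩
  -- arbitrary planes
  have hE : ∀ E : Submodule F V, finrank F E = 3 → ∃ j : ℕ, (q + 1) * subWeight wt E = W + (q + 1) * j := by
    intro E hE
    obtain ⟨Q, hQ, hQE⟩ := exists_point hE
    obtain ⟨H, hPle, hQH, hH⟩ := exists_plane₂ hdim hP hQ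
    obtain ⟨a, ha⟩ := sum_bool _ _ (hbup Q E hQ)
    obtain ⟨b, hb'⟩ := sum_bool _ _ (hbup Q H hQ)
    obtain ⟨N, hN⟩ := sum_bool _ _ (hbl E)
    rw [pen_eq wt hQ hE hQE] at ha
    rw [pen_eq wt hQ hH hQH] at hb'
    rw [plane_eq wt hE] at hN
    have hHW := hPH H hH hPle
    have e : (N : ℝ) = x + (q + 1) * (a - b) := by
      rw [← hx]; linear_combination -hN + (q + 1) * ha - (q + 1) * hb' + hHW
    have hba : b ≤ a := by
      by_contra hlt
      have h1 : (a : ℝ) + 1 ≤ b := by exact_mod_cast Nat.lt_of_not_le hlt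
      have h2 : (0 : ℝ) ≤ N := Nat.cast_nonneg N
      have h3 : (x : ℝ) < q := hx ▸ hW
      nlinarith
    refine ⟨a - b, ?_⟩
    rw [Nat.cast_sub hba]
    linear_combination hN + e - hx
  have hEge : ∀ E : Submodule F V, finrank F E = 3 → W ≤ (q + 1) * subWeight wt E := by
    intro E h
    obtain ⟨j, hj⟩ := hE E h
    have : (0 : ℝ) ≤ j := Nat.cast_nonneg j
    nlinarith
  have hcard : ∀ L : Submodule F V, finrank F L = 2 → ((up L ⊤).card : ℝ) = q + 1 := by
    intro L hL
    exact card_up_two le_top (by rw [finrank_top]; omega)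
  -- sum of excesses
  have hexc : ∀ L : Submodule F V, finrank F L = 2 →
      ∑ E ∈ up L ⊤, ((q + 1) * subWeight wt E - W) = (q + 1) * q * subWeight wt L := by
    intro L hL
    rw [Finset.sum_sub_distrib, ← Finset.mul_sum, planes_on_line wt hdim hL, Finset.sum_const,
      nsmul_eq_mul, hcard L hL]
    ring
  have hfull : ∀ E : Submodule F V, finrank F E = 3 → W < (q + 1) * subWeight wt E →
      ∀ L : Submodule F V, finrank F L = 2 → L ≤ E → subWeight wt L = 1 := by
    intro E hE3 hlt L hL hLE
    rcases hb L hL with h | h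
    · exfalso
      have h1 := hexc L hL
      rw [h, mul_zero, Finset.sum_eq_zero_iff_of_nonneg] at h1
      · have := h1 E (mem_up.mpr ⟨by omega, hLE, le_top⟩)
        linarith
      · intro E' hE'
        have := hEge E' (by rw [(mem_up.mp hE').1, hL])
        linarith
    · exact h
  by_cases hall : ∀ L : Submodule F V, finrank F L = 2 → subWeight wt L = 0
  · exact Or.inl hall
  right
  push Not at hall
  obtain ⟨L, hL, hL0⟩ := hall
  have hL1 : subWeight wt L = 1 := (hb L hL).resolve_left hL0
  obtain ⟨E, hE3, hlt⟩ : ∃ E : Submodule F V, finrank F E = 3 ∧ W < (q + 1) * subWeight wt E := by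
    by_contra hcon
    push Not at hcon
    have h1 := hexc L hL
    have h2 : ∑ E ∈ up L ⊤, ((q + 1) * subWeight wt E - W) ≤ 0 := by
      apply Finset.sum_nonpos
      intro E' hE'
      have := hcon E' (by rw [(mem_up.mp hE').1, hL])
      linarith
    rw [h1, hL1] at h2
    nlinarith
  have hEf := hfull E hE3 hlt
  have hsumE : ∑ L ∈ linesF E, subWeight wt L = q ^ 2 + q + 1 := by
    rw [Finset.sum_congr rfl (fun L hL => hEf L (mem_linesF.mp hL).1 (mem_linesF.mp hL).2)]
    rw [Finset.sum_const, nsmul_eq_mul, mul_one, card_linesF hE3]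
  have hx1 : x = 1 := by
    obtain ⟨j, hj⟩ := hE E hE3
    rw [← plane_eq wt hE3, hsumE, hx] at hj
    have hj' : (Fintype.card F : ℤ) ^ 2 + Fintype.card F + 1 = x + (Fintype.card F + 1) * j := by
      have : ((Fintype.card F : ℝ)) ^ 2 + Fintype.card F + 1 = x + (Fintype.card F + 1) * j := hj
      exact_mod_cast this
    have hxq : x < Fintype.card F := by
      have : (x : ℝ) < (Fintype.card F : ℝ) := hx ▸ hW
      exact_mod_cast this
    have hd : ((Fintype.card F : ℤ) + 1) ∣ ((x : ℤ) - 1) :=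
      ⟨(Fintype.card F : ℤ) - j, by linear_combination -hj'⟩
    have hq1 : 1 < Fintype.card F := Fintype.one_lt_card
    have := Int.eq_zero_of_abs_lt_dvd hd (by rw [abs_lt]; constructor <;> omega)
    omega
  have hW1 : W = 1 := by rw [hx, hx1]; norm_num
  refine ⟨E, hE3, ?_, ?_⟩
  · intro hPE
    have := hPH E hE3 hPE
    linarith
  · intro M hM
    refine ⟨fun hM1 => ?_, fun h => hEf M hM h⟩
    by_contra hME
    have h1 := all_eq wt hdim
    have h2 : ∑ L ∈ insert M (linesF E), subWeight wt L ≤ ∑ L ∈ linesF (⊤ : Submodule F V), subWeight wt L := by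
      apply Finset.sum_le_sum_of_subset_of_nonneg
      · intro L hL
        rw [Finset.mem_insert] at hL
        rw [mem_linesF]
        rcases hL with rfl | hL
        · exact ⟨hM, le_top⟩
        · exact ⟨(mem_linesF.mp hL).1, le_top⟩
      · intro L hL _
        rcases hbl _ L hL with h | h <;> rw [h]
        norm_num
    rw [Finset.sum_insert (fun h => hME (mem_linesF.mp h).2), hsumE, h1, hM1, ← hWdef, hW1] at h2
    linarith

/-- All lines through the heavy point belong to the family. -/
lemma heavy (wt : Submodule F V → ℝ) (hdim : finrank F V = 4)
    (hb : ∀ L : Submodule F V, finrank F L = 2 → subWeight wt L = 0 ∨ subWeight wt L = 1)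
    (P : Submodule F V) (hP : finrank F P = 1)
    (hw : (Fintype.card F : ℝ) / (Fintype.card F + 1) < wt P) :
    ∀ L : Submodule F V, finrank F L = 2 → P ≤ L → subWeight wt L = 1 := by
  have hq := q_two (F := F)
  set q : ℝ := (Fintype.card F : ℝ) with hqdef
  set W := subWeight wt ⊤ with hWdef
  have hw' : q ^ 2 < (q ^ 2 + q) * wt P := by
    rw [div_lt_iff₀ (by linarith)] at hw
    nlinarith
  have hle1 : ∀ L : Submodule F V, finrank F L = 2 → subWeight wt L ≤ 1 := by
    intro L hL
    rcases hb L hL with h | h <;> rw [h]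
    norm_num
  have hge0 : ∀ L : Submodule F V, finrank F L = 2 → 0 ≤ subWeight wt L := by
    intro L hL
    rcases hb L hL with h | h <;> rw [h]
    norm_num
  have hup2 : ∀ H L : Submodule F V, L ∈ up P H → finrank F L = 2 := by
    intro H L hL
    rw [(mem_up.mp hL).1, hP]
  have hstar := star_eq wt hdim hP
  intro L₀ hL₀ hPL₀
  by_contra hne
  have h0 : subWeight wt L₀ = 0 := (hb L₀ hL₀).resolve_right hne
  -- uniqueness of the missing line
  have huniq : ∀ L₁ : Submodule F V, finrank F L₁ = 2 → P ≤ L₁ → L₁ ≠ L₀ → subWeight wt L₁ = 1 := by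
    intro L₁ hL₁ hPL₁ hne₁
    by_contra hne'
    have h1 : subWeight wt L₁ = 0 := (hb L₁ hL₁).resolve_right hne'
    have hlt : L₀ ⊓ L₁ < L₀ := by
      refine lt_of_le_of_ne inf_le_left (fun h => hne₁ ?_)
      exact (Submodule.eq_of_le_of_finrank_eq (inf_eq_left.mp h) (by omega)).symm
    have h2 := Submodule.finrank_lt_finrank_of_lt hlt
    have h3 : 1 ≤ finrank F (L₀ ⊓ L₁ : Submodule F V) := by
      rw [← hP]; exact Submodule.finrank_mono (le_inf hPL₀ hPL₁)
    have h4 := Submodule.finrank_sup_add_finrank_inf_eq L₀ L₁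
    have hH : finrank F (L₀ ⊔ L₁ : Submodule F V) = 3 := by omega
    have hPH : P ≤ L₀ ⊔ L₁ := hPL₀.trans le_sup_left
    have hpen := pen_eq wt hP hH hPH
    have hN := plane_eq wt hH
    have hN0 : 0 ≤ ∑ L ∈ linesF (L₀ ⊔ L₁), subWeight wt L :=
      Finset.sum_nonneg (fun L hL => hge0 L (mem_linesF.mp hL).1)
    have hm0 : L₀ ∈ up P (L₀ ⊔ L₁) := mem_up.mpr ⟨by omega, hPL₀, le_sup_left⟩
    have hm1 : L₁ ∈ (up P (L₀ ⊔ L₁)).erase L₀ :=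
      Finset.mem_erase.mpr ⟨hne₁, mem_up.mpr ⟨by omega, hPL₁, le_sup_right⟩⟩
    have hb2 : ∑ L ∈ up P (L₀ ⊔ L₁), subWeight wt L ≤ q - 1 := by
      have hc := card_up_two hPH (by omega)
      rw [← Finset.add_sum_erase _ _ hm0, ← Finset.add_sum_erase _ _ hm1, h0, h1]
      have hc' : ∑ L ∈ ((up P (L₀ ⊔ L₁)).erase L₀).erase L₁, subWeight wt L ≤
          ∑ L ∈ ((up P (L₀ ⊔ L₁)).erase L₀).erase L₁, (1 : ℝ) :=
        Finset.sum_le_sum (fun L hL => hle1 L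
          (hup2 _ L (Finset.mem_of_mem_erase (Finset.mem_of_mem_erase hL))))
      have hk : ((((up P (L₀ ⊔ L₁)).erase L₀).erase L₁).card : ℝ) = q - 1 := by
        have e1 := Finset.card_erase_add_one hm0
        have e2 := Finset.card_erase_add_one hm1
        have e3 : (((((up P (L₀ ⊔ L₁)).erase L₀).erase L₁).card : ℝ)) + 1 + 1
            = (up P (L₀ ⊔ L₁)).card := by
          rw [← e1, ← e2]; push_cast; ring
        rw [hc] at e3; linarith
      rw [Finset.sum_const, nsmul_eq_mul, mul_one, hk] at hc'
      linarith
    rw [hN] at hN0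
    rw [hpen] at hb2
    nlinarith
  have hsum : ∀ H : Submodule F V, L₀ ≤ H → ∑ L ∈ up P H, subWeight wt L = ((up P H).card : ℝ) - 1 := by
    intro H hle
    have hm0 : L₀ ∈ up P H := mem_up.mpr ⟨by omega, hPL₀, hle⟩
    rw [← Finset.add_sum_erase _ _ hm0, h0, Finset.sum_congr rfl (fun L hL => huniq L
      (hup2 H L (Finset.mem_of_mem_erase hL)) (mem_up.mp (Finset.mem_of_mem_erase hL)).2.1
      (Finset.ne_of_mem_erase hL)), Finset.sum_const, nsmul_eq_mul,
      ← Finset.card_erase_add_one hm0]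
    push_cast; ring
  obtain ⟨H, hle, hH⟩ := exists_plane hdim L₀ (Or.inr hL₀)
  have hPH : P ≤ H := hPL₀.trans hle
  have hpen := pen_eq wt hP hH hPH
  have hN := plane_eq wt hH
  rw [hsum ⊤ le_top, card_up_three le_top (by rw [finrank_top]; omega)] at hstar
  have hNp : ∑ L ∈ up P H, subWeight wt L ≤ ∑ L ∈ linesF H, subWeight wt L := by
    apply Finset.sum_le_sum_of_subset_of_nonneg
    · intro L hL
      exact mem_linesF.mpr ⟨hup2 H L hL, (mem_up.mp hL).2.2⟩
    · intro L hL _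
      exact hge0 L (mem_linesF.mp hL).1
  rw [hN] at hNp
  rw [hsum H hle, card_up_two hPH (by omega)] at hpen hNp
  nlinarith

lemma subWeight_shift (wt : Submodule F V → ℝ) {P : Submodule F V} (hP : finrank F P = 1)
    (S : Submodule F V) :
    subWeight (fun Q => wt Q - if Q = P then 1 else 0) S
      = subWeight wt S - if P ≤ S then 1 else 0 := by
  rw [subWeight_eq, subWeight_eq, Finset.sum_sub_distrib, Finset.sum_ite_eq']
  simp [mem_pts, hP]

end helpers

open scoped Classical in
/-- If a Boolean degree 1 function on `J_q(4,2)` has a point of weight greater than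
`q/(q+1)`, then it is trivial and contains a point-pencil. -/
theorem stmt_8 (q : ℕ) (F V : Type) [Field F] [Fintype F] (hq : Fintype.card F = q)
    [AddCommGroup V] [Module F V] (hdim : finrank F V = 4)
    (wt : Submodule F V → ℝ) (Y : Set (Submodule F V)) (hY : Y ⊆ allLines F V)
    (hbool : ∀ L : Submodule F V, finrank F L = 2 →
      subWeight wt L = if L ∈ Y then 1 else 0)
    (P : Submodule F V) (hP : finrank F P = 1) (hw : (q : ℝ) / (q + 1) < wt P) :
    IsTrivialCL Y ∧ ∃ P' : Submodule F V, finrank F P' = 1 ∧ pencil P' ⊆ Y := by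
  subst hq
  haveI : Module.Finite F V := Module.finite_of_finrank_pos (by omega)
  have hb : ∀ L : Submodule F V, finrank F L = 2 → subWeight wt L = 0 ∨ subWeight wt L = 1 := by
    intro L hL
    rw [hbool L hL]
    split_ifs <;> simp
  have hin : ∀ L : Submodule F V, finrank F L = 2 → (subWeight wt L = 1 ↔ L ∈ Y) := by
    intro L hL
    rw [hbool L hL]
    split_ifs with h <;> simp [h]
  have hheavy := heavy wt hdim hb P hP hw
  have hpen : pencil P ⊆ Y := fun L hL => (hin L hL.1).mp (hheavy L hL.1 hL.2)
  refine ⟨?_, P, hP, hpen⟩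
  have hq2 := q_two (F := F)
  have hW : subWeight wt ⊤ < (Fintype.card F : ℝ) + 1 := by
    have h1 := star_eq wt hdim hP
    rw [Finset.sum_congr rfl (fun L hL => hheavy L (by rw [(mem_up.mp hL).1, hP])
      (mem_up.mp hL).2.1), Finset.sum_const, nsmul_eq_mul, mul_one,
      card_up_three le_top (by rw [finrank_top]; omega)] at h1
    rw [div_lt_iff₀ (by linarith)] at hw
    nlinarith
  have hs := subWeight_shift wt hP
  have hcore := core (fun Q => wt Q - if Q = P then 1 else 0) hdim
    (by
      intro L hL
      rw [hs]
      by_cases h : P ≤ L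
      · rw [if_pos h, hheavy L hL h]; simp
      · rw [if_neg h, sub_zero]; exact hb L hL)
    P hP
    (by
      intro L hL h
      rw [hs, if_pos h, hheavy L hL h]; simp)
    (by rw [hs, if_pos le_top]; linarith)
  rcases hcore with h | ⟨E, hE, hPE, h⟩
  · refine ⟨pencil P, Or.inr (Or.inl ⟨P, hP, rfl⟩), Or.inl (Set.Subset.antisymm ?_ hpen)⟩
    intro L hL
    have hL2 : finrank F L = 2 := hY hL
    refine ⟨hL2, ?_⟩
    by_contra hn
    have h1 := h L hL2
    rw [hs, if_neg hn, (hin L hL2).mpr hL] at h1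
    norm_num at h1
  · refine ⟨pencil P ∪ linesIn E, Or.inr (Or.inr (Or.inr ⟨P, E, hP, by omega, hPE, rfl⟩)),
      Or.inl (Set.Subset.antisymm ?_ (Set.union_subset hpen ?_))⟩
    · intro L hL
      have hL2 : finrank F L = 2 := hY hL
      by_cases hn : P ≤ L
      · exact Or.inl ⟨hL2, hn⟩
      · refine Or.inr ⟨hL2, (h L hL2).mp ?_⟩
        rw [hs, if_neg hn, (hin L hL2).mpr hL, sub_zero]
    · rintro L ⟨hL2, hLE⟩
      have h1 := (h L hL2).mpr hLE
      have hn : ¬ P ≤ L := fun hh => hPE (hh.trans hLE)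
      rw [hs, if_neg hn, sub_zero] at h1
      exact (hin L hL2).mp h1
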